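/- The complement S⁶ \ T (with its subspace topology) is a simply connected space, where T = {x ∈ S⁶ : x₁² + x₂² + x₃² = 1/2 and x₄² + x₅² = 1/2}. -/

import Mathlib

/- STATEMENT 7: The complement S⁶ \ T (with its subspace topology) is simply
   connected, where T = {x ∈ S⁶ : x₁²+x₂²+x₃² = 1/2 and x₄²+x₅² = 1/2}. -/

noncomputable section

abbrev E (n : ℕ) : Type := EuclideanSpace ℝ (Fin n)

/-- The standard torus `T ⊂ S⁶`. -/
def T : Set (E 7) :=
  {x | x ∈ Metric.sphere (0 : E 7) 1 ∧
       x 0 ^ 2 + x 1 ^ 2 + x 2 ^ 2 = 1 / 2 ∧ x 3 ^ 2 + x 4 ^ 2 = 1 / 2}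

section VanKampen

open Topology Filter
open scoped unitInterval

variable {X : Type*} [TopologicalSpace X] {U V : Set X}

/-- Two paths with the same endpoints inside a simply connected set are homotopic. -/
theorem IsSimplyConnected.path_homotopic (hU : IsSimplyConnected U) {x y : X} (p q : Path x y)
    (hp : ∀ t, p t ∈ U) (hq : ∀ t, q t ∈ U) : p.Homotopic q := by
  have := hU.simplyConnectedSpace
  have hx : x ∈ U := by simpa using hp 0
  have hy : y ∈ U := by simpa using hp 1
  let p' : Path (⟨x, hx⟩ : U) ⟨y, hy⟩ :=
    { toFun t := ⟨p t, hp t⟩, source' := by simp, target' := by simp }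
  let q' : Path (⟨x, hx⟩ : U) ⟨y, hy⟩ :=
    { toFun t := ⟨q t, hq t⟩, source' := by simp, target' := by simp }
  exact (SimplyConnectedSpace.paths_homotopic p' q').map ⟨Subtype.val, continuous_subtype_val⟩

theorem Path.Homotopic.Quotient.mk_subpath_trans {x y : X} (γ : Path x y) (r s t : I) :
    (mk (γ.subpath r s)).trans (mk (γ.subpath s t)) = mk (γ.subpath r t) := by
  rw [← mk_trans, Path.Homotopic.Quotient.eq]
  exact ⟨Path.Homotopy.subpathTransSubpath γ r s t⟩

open Path.Homotopic.Quotient in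
/-- A family of homotopy classes of paths out of a base point that is compatible with short
subpaths is compatible with all paths. -/
theorem Path.Homotopic.Quotient.trans_eq_of_locally {x₀ : X}
    (κ : ∀ x, Path.Homotopic.Quotient x₀ x) {x y : X} (γ : Path x y)
    (h : ∀ t : I, ∀ᶠ s in 𝓝 t, (κ (γ t)).trans (mk (γ.subpath t s)) = κ (γ s)) :
    (κ x).trans (mk γ) = κ y := by
  let P (t s : I) : Prop := (κ (γ t)).trans (mk (γ.subpath t s)) = κ (γ s)
  have hsymm : Std.Symm P := ⟨fun s t (hst : _ = _) ↦ by
    dsimp only [P]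
    rw [← hst, trans_assoc, mk_subpath_trans, Path.subpath_self, mk_refl, trans_refl]⟩
  have htrans : IsTrans I P := ⟨fun r s t (hrs : _ = _) (hst : _ = _) ↦ by
    dsimp only [P]
    rw [← hst, ← hrs, trans_assoc, mk_subpath_trans]⟩
  have key : P 0 1 := PreconnectedSpace.induction₂ P h htrans 0 1
  dsimp only [P] at key
  rw [Path.subpath_zero_one] at key
  obtain ⟨f, rfl, rfl⟩ := γ
  exact key

/-- The special case of van Kampen's theorem for simply connected pieces. -/
theorem simplyConnectedSpace_of_union_eq_univ (hUo : IsOpen U) (hVo : IsOpen V)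
    (hU : IsSimplyConnected U) (hV : IsSimplyConnected V) (hUV : IsPathConnected (U ∩ V))
    (hcov : U ∪ V = Set.univ) : SimplyConnectedSpace X := by
  obtain ⟨x₀, hx₀⟩ := hUV.nonempty
  have hpc : PathConnectedSpace X := by
    rw [pathConnectedSpace_iff_univ, ← hcov]
    exact hU.isPathConnected.union hV.isPathConnected ⟨x₀, hx₀⟩
  have hκ : ∀ x, ∃ k : Path.Homotopic.Quotient x₀ x, ∀ p : Path x₀ x,
      ((∀ t, p t ∈ U) ∨ ∀ t, p t ∈ V) → Path.Homotopic.Quotient.mk p = k := by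
    intro x
    by_cases hxU : x ∈ U <;> by_cases hxV : x ∈ V
    · obtain ⟨r, hr⟩ := hUV.joinedIn x₀ hx₀ x ⟨hxU, hxV⟩
      refine ⟨.mk r, fun p hp ↦ Path.Homotopic.Quotient.eq.2 ?_⟩
      exact hp.elim (fun hp ↦ hU.path_homotopic p r hp fun t ↦ (hr t).1)
        (fun hp ↦ hV.path_homotopic p r hp fun t ↦ (hr t).2)
    · obtain ⟨r, hr⟩ := hU.isPathConnected.joinedIn x₀ hx₀.1 x hxU
      refine ⟨.mk r, fun p hp ↦ Path.Homotopic.Quotient.eq.2 ?_⟩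
      exact hp.elim (fun hp ↦ hU.path_homotopic p r hp hr)
        (fun hp ↦ absurd (by simpa using hp 1) hxV)
    · obtain ⟨r, hr⟩ := hV.isPathConnected.joinedIn x₀ hx₀.2 x hxV
      refine ⟨.mk r, fun p hp ↦ Path.Homotopic.Quotient.eq.2 ?_⟩
      exact hp.elim (fun hp ↦ absurd (by simpa using hp 1) hxU)
        (fun hp ↦ hV.path_homotopic p r hp hr)
    · have : x ∈ U ∪ V := hcov ▸ Set.mem_univ x
      exact absurd this (by simp [hxU, hxV])
  choose κ hκ using hκ
  have hlocal : ∀ W : Set X, IsOpen W → IsPathConnected W → x₀ ∈ W →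
      (∀ x, ∀ p : Path x₀ x, (∀ t, p t ∈ W) → Path.Homotopic.Quotient.mk p = κ x) →
      ∀ {x y : X} (γ : Path x y) (t : I), γ t ∈ W →
        ∀ᶠ s in 𝓝 t, (κ (γ t)).trans (.mk (γ.subpath t s)) = κ (γ s) := by
    intro W hWo hW hxW hκW x y γ t ht
    have hnhds : γ ⁻¹' W ∈ 𝓝 t := γ.continuous.continuousAt.preimage_mem_nhds (hWo.mem_nhds ht)
    have hsmall : ∀ᶠ s in 𝓝 t, Set.uIcc t s ⊆ γ ⁻¹' W :=
      (Filter.Tendsto.uIcc tendsto_const_nhds tendsto_id).eventually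
        (eventually_smallSets_subset.2 hnhds)
    filter_upwards [hsmall] with s hs
    obtain ⟨r, hr⟩ := hW.joinedIn x₀ hxW (γ t) ht
    rw [← hκW _ r hr, ← Path.Homotopic.Quotient.mk_trans]
    refine hκW _ _ fun u ↦ ?_
    have hsub : ∀ u, γ.subpath t s u ∈ W := fun u ↦ by
      have : γ.subpath t s u ∈ γ '' Set.uIcc t s := γ.range_subpath t s ▸ ⟨u, rfl⟩
      exact Set.image_subset_iff.2 hs this
    have : r.trans (γ.subpath t s) u ∈ Set.range r ∪ Set.range (γ.subpath t s) :=
      Path.trans_range r (γ.subpath t s) ▸ ⟨u, rfl⟩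
    rcases this with ⟨v, hv⟩ | ⟨v, hv⟩ <;> rw [← hv]
    exacts [hr v, hsub v]
  have hκtrans : ∀ {x y : X} (γ : Path x y), (κ x).trans (.mk γ) = κ y := fun γ ↦
    Path.Homotopic.Quotient.trans_eq_of_locally κ γ fun t ↦ by
      rcases (hcov ▸ Set.mem_univ (γ t) : γ t ∈ U ∪ V) with ht | ht
      · exact hlocal U hUo hU.isPathConnected hx₀.1 (fun x p hp ↦ hκ x p (.inl hp)) γ t ht
      · exact hlocal V hVo hV.isPathConnected hx₀.2 (fun x p hp ↦ hκ x p (.inr hp)) γ t ht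
  refine simply_connected_iff_paths_homotopic'.2 ⟨hpc, fun {x y} p q ↦ ?_⟩
  rw [← Path.Homotopic.Quotient.eq]
  have h := congrArg ((κ x).symm.trans) ((hκtrans p).trans (hκtrans q).symm)
  simpa [← Path.Homotopic.Quotient.trans_assoc] using h

theorem IsSimplyConnected.union (hUo : IsOpen U) (hVo : IsOpen V)
    (hU : IsSimplyConnected U) (hV : IsSimplyConnected V) (hUV : IsPathConnected (U ∩ V)) :
    IsSimplyConnected (U ∪ V) := by
  have hemb : IsEmbedding (Subtype.val : ↥(U ∪ V) → X) := IsEmbedding.subtypeVal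
  refine simplyConnectedSpace_of_union_eq_univ (U := Subtype.val ⁻¹' U) (V := Subtype.val ⁻¹' V)
    (hUo.preimage continuous_subtype_val) (hVo.preimage continuous_subtype_val) ?_ ?_ ?_ ?_
  · rwa [← hemb.isSimplyConnected_image, Subtype.image_preimage_val,
      Set.inter_eq_right.2 Set.subset_union_left]
  · rwa [← hemb.isSimplyConnected_image, Subtype.image_preimage_val,
      Set.inter_eq_right.2 Set.subset_union_right]
  · rwa [← Set.preimage_inter, hemb.isInducing.isPathConnected_iff, Subtype.image_preimage_val,
      Set.inter_eq_right.2 (Set.inter_subset_left.trans Set.subset_union_left)]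
  · exact Set.eq_univ_of_forall Subtype.prop

end VanKampen

section Deformation

variable {F G : Type*} [AddCommGroup F] [Module ℝ F] [TopologicalSpace F]
  [IsTopologicalAddGroup F] [ContinuousSMul ℝ F] [TopologicalSpace G]

/-- Simple connectedness transfers along a section-retraction pair whose composite on the larger
set is joined to the identity by straight segments inside that set. -/
theorem isSimplyConnected_of_segment_subset {s : Set F} {t : Set G} {f : F → G} {g : G → F}
    (hf : ContinuousOn f s) (hg : ContinuousOn g t) (hfs : Set.MapsTo f s t)
    (hgt : Set.MapsTo g t s) (hfg : Set.LeftInvOn f g t)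
    (hseg : ∀ x ∈ s, segment ℝ (g (f x)) x ⊆ s) :
    IsSimplyConnected s ↔ IsSimplyConnected t := by
  let f' : C(s, t) := ⟨hfs.restrict f s t, hf.mapsToRestrict hfs⟩
  let g' : C(t, s) := ⟨hgt.restrict g t s, hg.mapsToRestrict hgt⟩
  let i : C(s, F) := ⟨Subtype.val, continuous_subtype_val⟩
  let H := ContinuousMap.Homotopy.affine (i.comp (g'.comp f')) i
  have hH : ∀ z, H z ∈ s := fun z ↦ hseg z.2 z.2.2 <| by
    rw [segment_eq_image_lineMap]
    exact ⟨z.1, z.1.2, rfl⟩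
  let e : ContinuousMap.HomotopyEquiv s t :=
    { toFun := f'
      invFun := g'
      left_inv := ⟨{
        toFun z := ⟨H z, hH z⟩
        continuous_toFun := H.continuous.subtype_mk hH
        map_zero_left x := Subtype.ext (H.map_zero_left x)
        map_one_left x := Subtype.ext (H.map_one_left x) }⟩
      right_inv := by
        have : f'.comp g' = ContinuousMap.id t := by
          ext x
          exact congrArg _ (Subtype.ext (hfg x.2))
        rw [this] }
  exact e.simplyConnectedSpace_iff

end Deformation

section NormedSpace

variable {A B C : Type*} [NormedAddCommGroup A] [NormedSpace ℝ A]
  [NormedAddCommGroup B] [NormedSpace ℝ B] [NormedAddCommGroup C] [NormedSpace ℝ C]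

theorem isSimplyConnected_snd_ne_zero_or {Y : Type*} [TopologicalSpace Y] [PathConnectedSpace Y]
    (hC : 1 < Module.rank ℝ C) {f : Y → ℝ} (hf : Continuous f)
    (hpos : IsSimplyConnected {z : Y × C | z.2 ≠ 0 ∨ 0 < f z.1})
    (hneg : IsSimplyConnected {z : Y × C | z.2 ≠ 0 ∨ f z.1 < 0}) :
    IsSimplyConnected {z : Y × C | z.2 ≠ 0 ∨ f z.1 ≠ 0} := by
  have hne : IsOpen {z : Y × C | z.2 ≠ 0} := isOpen_ne_fun continuous_snd continuous_const
  have hunion : {z : Y × C | z.2 ≠ 0 ∨ f z.1 ≠ 0} =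
      {z | z.2 ≠ 0 ∨ 0 < f z.1} ∪ {z | z.2 ≠ 0 ∨ f z.1 < 0} := by
    ext z
    simp only [Set.mem_ofPred_eq, Set.mem_union, ne_iff_lt_or_gt (a := f z.1)]
    tauto
  have hinter : {z : Y × C | z.2 ≠ 0 ∨ 0 < f z.1} ∩ {z | z.2 ≠ 0 ∨ f z.1 < 0} =
      Set.univ ×ˢ {0}ᶜ := by
    ext z
    have := lt_asymm (a := 0) (b := f z.1)
    simp only [Set.mem_ofPred_eq, Set.mem_inter_iff, Set.mem_prod, Set.mem_univ,
      Set.mem_compl_iff, Set.mem_singleton_iff]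
    tauto
  rw [hunion]
  refine IsSimplyConnected.union (hne.union (isOpen_lt continuous_const (hf.comp continuous_fst)))
    (hne.union (isOpen_lt (hf.comp continuous_fst) continuous_const)) hpos hneg ?_
  rw [hinter]
  exact isPathConnected_univ.prod (isPathConnected_compl_singleton_of_one_lt_rank hC 0)

theorem StarConvex.isSimplyConnected {s : Set A} {x : A} (hs : StarConvex ℝ x s)
    (hne : s.Nonempty) : IsSimplyConnected s :=
  have := hs.contractibleSpace hne
  SimplyConnectedSpace.ofContractible s

theorem isSimplyConnected_prod_compl_zero (hC : 1 < Module.rank ℝ C) :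
    IsSimplyConnected ({0}ᶜ : Set (ℝ × C)) := by
  have hcompl : ({0}ᶜ : Set (ℝ × C)) = {z | z.2 ≠ 0 ∨ z.1 ≠ 0} := by
    ext z
    simp only [Set.mem_compl_iff, Set.mem_singleton_iff, Prod.ext_iff, Set.mem_ofPred_eq,
      Prod.fst_zero, Prod.snd_zero]
    tauto
  rw [hcompl]
  refine isSimplyConnected_snd_ne_zero_or hC continuous_id ?_ ?_
  · refine StarConvex.isSimplyConnected (x := ((1 : ℝ), (0 : C))) ?_ ⟨(1, 0), by simp⟩
    rintro ⟨r, c⟩ hz a b ha hb hab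
    rcases hb.eq_or_lt with rfl | hb
    · simp_all
    · rcases hz with hz | hz
      · left
        simpa [hb.ne'] using hz
      · right
        simp only [id, Prod.fst_add, Prod.smul_fst, smul_eq_mul] at hz ⊢
        positivity
  · refine StarConvex.isSimplyConnected (x := ((-1 : ℝ), (0 : C))) ?_ ⟨(-1, 0), by simp⟩
    rintro ⟨r, c⟩ hz a b ha hb hab
    rcases hb.eq_or_lt with rfl | hb
    · simp_all
    · rcases hz with hz | hz
      · left
        simpa [hb.ne'] using hz
      · right
        simp only [id, Prod.fst_add, Prod.smul_fst, smul_eq_mul] at hz ⊢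
        nlinarith

/-- The complement of the origin is simply connected in dimension at least three. -/
theorem isSimplyConnected_compl_zero [FiniteDimensional ℝ A] (hA : 2 < Module.finrank ℝ A) :
    IsSimplyConnected ({0}ᶜ : Set A) := by
  let C := EuclideanSpace ℝ (Fin (Module.finrank ℝ A - 1))
  have hC : 1 < Module.rank ℝ C := by
    rw [← Module.finrank_eq_rank]
    simp only [C, finrank_euclideanSpace_fin]
    exact_mod_cast (by omega : 1 < Module.finrank ℝ A - 1)
  let e : A ≃L[ℝ] ℝ × C := ContinuousLinearEquiv.ofFinrankEq (by simp [C]; omega)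
  have himage : (e.toHomeomorph : A → ℝ × C) ⁻¹' {0}ᶜ = {0}ᶜ := by
    ext x
    simp
  rw [← himage, Homeomorph.isSimplyConnected_preimage]
  exact isSimplyConnected_prod_compl_zero hC

theorem isSimplyConnected_norm_lt_norm [FiniteDimensional ℝ A] [FiniteDimensional ℝ C]
    (hAC : 2 < Module.finrank ℝ (A × C)) :
    IsSimplyConnected {z : (A × B) × C | z.2 ≠ 0 ∨ ‖z.1.2‖ < ‖z.1.1‖} := by
  refine (isSimplyConnected_of_segment_subset (t := {0}ᶜ)
    (f := fun z : (A × B) × C ↦ (z.1.1, z.2)) (g := fun w : A × C ↦ ((w.1, (0 : B)), w.2))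
    (by fun_prop) (by fun_prop) ?_ ?_ (fun _ _ ↦ rfl) ?_).2 (isSimplyConnected_compl_zero hAC)
  · rintro ⟨⟨a, b⟩, c⟩ (hc | hab) h0
    · exact hc (congrArg Prod.snd h0)
    · have : a = 0 := congrArg Prod.fst h0
      simp only [this, norm_zero] at hab
      exact (norm_nonneg b).not_gt hab
  · rintro ⟨a, c⟩ h0
    simp only [Set.mem_compl_iff, Set.mem_singleton_iff, Prod.ext_iff, Prod.fst_zero,
      Prod.snd_zero, not_and_or] at h0
    simpa [or_comm] using h0
  · rintro ⟨⟨a, b⟩, c⟩ hz _ ⟨p, q, hp, hq, hpq, rfl⟩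
    have hc : p • c + q • c = c := by rw [← add_smul, hpq, one_smul]
    have ha : p • a + q • a = a := by rw [← add_smul, hpq, one_smul]
    simp only [Set.mem_ofPred_eq, Prod.snd_add, Prod.smul_snd, Prod.fst_add, Prod.smul_fst, hc, ha,
      smul_zero, zero_add, norm_smul, Real.norm_of_nonneg hq] at hz ⊢
    exact hz.imp_right fun h ↦
      (mul_le_of_le_one_left (norm_nonneg b) (by linarith)).trans_lt h

theorem isSimplyConnected_norm_ne_norm [FiniteDimensional ℝ A] [FiniteDimensional ℝ B]
    [FiniteDimensional ℝ C] (hC : 1 < Module.finrank ℝ C)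
    (hAC : 2 < Module.finrank ℝ (A × C)) (hBC : 2 < Module.finrank ℝ (B × C)) :
    IsSimplyConnected {z : (A × B) × C | z.2 ≠ 0 ∨ ‖z.1.1‖ ≠ ‖z.1.2‖} := by
  have hrank : 1 < Module.rank ℝ C := by
    rw [← Module.finrank_eq_rank]
    exact_mod_cast hC
  have h := isSimplyConnected_snd_ne_zero_or (Y := A × B) (f := fun y ↦ ‖y.1‖ - ‖y.2‖) hrank
    (by fun_prop) (by simpa only [sub_pos] using isSimplyConnected_norm_lt_norm hAC) ?_
  · simpa only [sub_ne_zero] using h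
  · have hswap := ((Homeomorph.prodComm A B).prodCongr
      (Homeomorph.refl C)).isSimplyConnected_preimage.2 (isSimplyConnected_norm_lt_norm (B := A) hBC)
    simp only [sub_neg]
    exact hswap

/-- A cone avoiding the origin retracts onto its intersection with the unit sphere. -/
theorem isSimplyConnected_sphere_inter_iff {K : Set A} (h0 : 0 ∉ K)
    (hK : ∀ x ∈ K, ∀ r : ℝ, 0 < r → r • x ∈ K) :
    IsSimplyConnected (Metric.sphere 0 1 ∩ K) ↔ IsSimplyConnected K := by
  have hpos : ∀ x ∈ K, 0 < ‖x‖ := fun x hx ↦ norm_pos_iff.2 fun h ↦ h0 (h ▸ hx)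
  symm
  refine isSimplyConnected_of_segment_subset (f := fun x ↦ ‖x‖⁻¹ • x) (g := id)
    ?_ continuousOn_id ?_ Set.inter_subset_right ?_ ?_
  · exact (continuousOn_id.norm.inv₀ fun x hx ↦ (hpos x hx).ne').smul continuousOn_id
  · intro x hx
    have := hpos x hx
    refine ⟨?_, hK x hx _ (inv_pos.2 this)⟩
    simp [norm_smul, this.ne']
  · rintro x ⟨hx, -⟩
    simp [mem_sphere_zero_iff_norm.1 hx]
  · rintro x hx _ ⟨p, q, hp, hq, hpq, rfl⟩
    have := hpos x hx
    rw [id, smul_smul, ← add_smul]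
    refine hK x hx _ ?_
    rcases hq.eq_or_lt with rfl | hq
    · rw [add_zero] at hpq
      rw [hpq]
      positivity
    · positivity

end NormedSpace

/-- The splitting `ℝ⁷ = (ℝ³ × ℝ²) × ℝ²` by blocks of coordinates. -/
def blockHomeomorph : E 7 ≃ₜ (E 3 × E 2) × E 2 where
  toFun x := ((!₂[x 0, x 1, x 2], !₂[x 3, x 4]), !₂[x 5, x 6])
  invFun z := !₂[z.1.1 0, z.1.1 1, z.1.1 2, z.1.2 0, z.1.2 1, z.2 0, z.2 1]
  left_inv x := by
    ext i
    fin_cases i <;> rfl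
  right_inv z := by
    refine Prod.ext (Prod.ext ?_ ?_) ?_ <;> ext i <;> fin_cases i <;> rfl
  continuous_toFun := by fun_prop
  continuous_invFun := by fun_prop

/-- The cone over the complement of `T` in the sphere. -/
def complementCone : Set (E 7) :=
  {x | (x 5 ≠ 0 ∨ x 6 ≠ 0) ∨ x 0 ^ 2 + x 1 ^ 2 + x 2 ^ 2 ≠ x 3 ^ 2 + x 4 ^ 2}

theorem isSimplyConnected_complementCone : IsSimplyConnected complementCone := by
  have hpre : complementCone = blockHomeomorph ⁻¹' {z | z.2 ≠ 0 ∨ ‖z.1.1‖ ≠ ‖z.1.2‖} := by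
    ext x
    have hsq : ‖(blockHomeomorph x).1.1‖ = ‖(blockHomeomorph x).1.2‖ ↔
        x 0 ^ 2 + x 1 ^ 2 + x 2 ^ 2 = x 3 ^ 2 + x 4 ^ 2 := by
      rw [← sq_eq_sq₀ (norm_nonneg _) (norm_nonneg _), EuclideanSpace.real_norm_sq_eq,
        EuclideanSpace.real_norm_sq_eq, Fin.sum_univ_three, Fin.sum_univ_two]
      rfl
    have hz : (blockHomeomorph x).2 = 0 ↔ x 5 = 0 ∧ x 6 = 0 := by
      rw [PiLp.ext_iff, Fin.forall_fin_two]
      rfl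
    simp only [complementCone, Set.mem_ofPred_eq, Set.mem_preimage, ne_eq, hsq, hz]
    tauto
  rw [hpre, Homeomorph.isSimplyConnected_preimage]
  exact isSimplyConnected_norm_ne_norm (by simp) (by simp) (by simp)

theorem sphere_sdiff_T :
    Metric.sphere (0 : E 7) 1 \ T = Metric.sphere 0 1 ∩ complementCone := by
  ext x
  refine and_congr_right fun hx ↦ ?_
  have hsum : x 0 ^ 2 + x 1 ^ 2 + x 2 ^ 2 + x 3 ^ 2 + x 4 ^ 2 + x 5 ^ 2 + x 6 ^ 2 = 1 := by
    have := EuclideanSpace.real_norm_sq_eq x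
    rw [mem_sphere_zero_iff_norm.1 hx, Fin.sum_univ_seven] at this
    linarith
  rw [complementCone, Set.mem_ofPred_eq, not_iff_comm]
  push Not
  refine ⟨fun ⟨⟨h5, h6⟩, h⟩ ↦ ?_, fun ⟨_, ha, hb⟩ ↦ ⟨⟨?_, ?_⟩, ha.trans hb.symm⟩⟩
  · rw [h5, h6] at hsum
    exact ⟨hx, by linarith, by linarith⟩
  all_goals
    rw [← sq_eq_zero_iff]
    nlinarith [sq_nonneg (x 5), sq_nonneg (x 6)]

theorem statement7 :
    SimplyConnectedSpace (Metric.sphere (0 : E 7) 1 \ T : Set (E 7)) := by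
  rw [sphere_sdiff_T]
  refine (isSimplyConnected_sphere_inter_iff (by simp [complementCone]) fun x hx r hr ↦ ?_).2
    isSimplyConnected_complementCone
  refine hx.imp (fun h ↦ by simpa [hr.ne'] using h) fun h h' ↦ h ?_
  simp only [PiLp.smul_apply, smul_eq_mul, mul_pow, ← mul_add] at h'
  exact mul_left_cancel₀ (pow_pos hr 2).ne' h'
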